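/- arXiv:1309.1791 — 3 statements merged into one kernel-verified Lean document; each statement's English description precedes it below -/
import Mathlib

section
/- Let H be a complex vector space equipped with an inner product (e.g. a Hilbert space), n ≥ 1, and let V be a linear subspace of the algebraic tensor product H ⊗ ℂⁿ such that for every unitary matrix U ∈ U(n), the operator id_H ⊗ U maps V onto V. Then there exists a linear subspace V' of H such that V = V' ⊗ ℂⁿ, i.e. V equals the linear span of the set of elementary tensors {v ⊗ c : v ∈ V', c ∈ ℂⁿ}. -/
open TensorProduct

open scoped Matrix.Norms.L2Operator in
/-- Every complex matrix is a linear combination of unitary matrices. -/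
theorem Matrix.span_unitaryGroup_eq_top (n : ℕ) :
    Submodule.span ℂ (Matrix.unitaryGroup (Fin n) ℂ : Set (Matrix (Fin n) (Fin n) ℂ)) = ⊤ :=
  CStarAlgebra.span_unitary _

/-- A subspace of `H ⊗ ℂⁿ` invariant under `id_H ⊗ U` for unitary `U` is invariant under
`id_H ⊗ A` for every matrix `A`. -/
theorem lTensor_mulVecLin_mem_of_forall_unitary {H : Type*} [AddCommGroup H] [Module ℂ H] {n : ℕ}
    {V : Submodule ℂ (H ⊗[ℂ] (Fin n → ℂ))}
    (hV : ∀ U ∈ Matrix.unitaryGroup (Fin n) ℂ, V.map (LinearMap.lTensor H U.mulVecLin) ≤ V)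
    (A : Matrix (Fin n) (Fin n) ℂ) {x : H ⊗[ℂ] (Fin n → ℂ)} (hx : x ∈ V) :
    LinearMap.lTensor H A.mulVecLin x ∈ V := by
  have hA : A ∈ Submodule.span ℂ
      (Matrix.unitaryGroup (Fin n) ℂ : Set (Matrix (Fin n) (Fin n) ℂ)) := by
    rw [Matrix.span_unitaryGroup_eq_top]; trivial
  induction hA using Submodule.span_induction with
  | mem U hU => exact hV U hU (Submodule.mem_map_of_mem hx)
  | zero => simp
  | add B C _ _ hB hC =>
    rw [Matrix.mulVecLin_add, LinearMap.lTensor_add]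
    exact V.add_mem hB hC
  | smul a B _ hB =>
    rw [show (a • B).mulVecLin = a • B.mulVecLin from
        LinearMap.ext fun v ↦ Matrix.smul_mulVec a B v,
      LinearMap.lTensor_smul]
    exact V.smul_mem a hB

/-- Applying `id ⊗ (c eᵢᵀ)` to `x` gives the elementary tensor of the `i`-th component of `x`
with `c`. -/
theorem lTensor_mulVecLin_vecMulVec_single {H : Type*} [AddCommGroup H] [Module ℂ H] {n : ℕ}
    (i : Fin n) (c : Fin n → ℂ) (x : H ⊗[ℂ] (Fin n → ℂ)) :
    LinearMap.lTensor H (Matrix.vecMulVec c (Pi.single i 1)).mulVecLin x =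
      TensorProduct.piScalarRight ℂ ℂ H (Fin n) x i ⊗ₜ[ℂ] c := by
  induction x with
  | zero => simp
  | add x y hx hy => simp [hx, hy, TensorProduct.add_tmul]
  | tmul v u =>
    rw [LinearMap.lTensor_tmul, Matrix.mulVecLin_apply, Matrix.vecMulVec_mulVec]
    simp [TensorProduct.smul_tmul]

/-- Detensoring lemma: a subspace `V` of `H ⊗ ℂⁿ` that is invariant (onto) under all
maps `id_H ⊗ U` with `U` unitary is of the form `V' ⊗ ℂⁿ` for a subspace `V'` of `H`,
i.e. `V` is the span of the elementary tensors `v ⊗ c` with `v ∈ V'` and `c ∈ ℂⁿ`. -/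
theorem detensoring_lemma
    (H : Type) [NormedAddCommGroup H] [InnerProductSpace ℂ H]
    (n : ℕ) (hn : 1 ≤ n)
    (V : Submodule ℂ (H ⊗[ℂ] (Fin n → ℂ)))
    (hV : ∀ U : Matrix (Fin n) (Fin n) ℂ, U ∈ Matrix.unitaryGroup (Fin n) ℂ →
      Submodule.map (LinearMap.lTensor H U.mulVecLin) V = V) :
    ∃ V' : Submodule ℂ H,
      V = Submodule.span ℂ
        {x : H ⊗[ℂ] (Fin n → ℂ) | ∃ v ∈ V', ∃ c : Fin n → ℂ, x = v ⊗ₜ[ℂ] c} := by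
  let V' : Submodule ℂ H := ⨅ c : Fin n → ℂ, V.comap ((TensorProduct.mk ℂ H (Fin n → ℂ)).flip c)
  have mem_V' (v : H) : v ∈ V' ↔ ∀ c : Fin n → ℂ, v ⊗ₜ[ℂ] c ∈ V := by
    simp [V', Submodule.mem_iInf]
  refine ⟨V', le_antisymm (fun x hx ↦ ?_) (Submodule.span_le.2 ?_)⟩
  · rw [← (TensorProduct.piScalarRight ℂ ℂ H (Fin n)).symm_apply_apply x,
      ← Finset.univ_sum_single (TensorProduct.piScalarRight ℂ ℂ H (Fin n) x), map_sum]
    refine Submodule.sum_mem _ fun i _ ↦ Submodule.subset_span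
      ⟨_, (mem_V' _).2 fun c ↦ ?_, Pi.single i 1,
        TensorProduct.piScalarRight_symm_single ℂ ℂ H (Fin n) _ i⟩
    rw [← lTensor_mulVecLin_vecMulVec_single]
    exact lTensor_mulVecLin_mem_of_forall_unitary (fun U hU ↦ (hV U hU).le) _ hx
  · rintro _ ⟨v, hv, c, rfl⟩
    exact (mem_V' v).1 hv c
end

section
/- Let ℍ = {z ∈ ℂ : Im z > 0} and let h : ℍ → ℂ. Then h is holomorphic on ℍ with Im h(z) ≥ 0 for all z ∈ ℍ if and only if there exist a ∈ ℝ, b ≥ 0, and a finite positive Borel measure μ on ℝ such that h(z) = a + bz + ∫_ℝ (1 + tz)/(t − z) dμ(t) for all z ∈ ℍ. Moreover, for any such h the numbers a ∈ ℝ, b ≥ 0 and the measure μ are uniquely determined. -/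
open MeasureTheory

section

open scoped NNReal ENNReal BoundedContinuousFunction Topology

lemma ofReal_sub_ne_zero_of_im_pos {z : ℂ} (hz : 0 < z.im) (t : ℝ) : (t : ℂ) - z ≠ 0 := by
  intro h
  have := congrArg Complex.im h
  simp at this
  linarith

lemma im_le_norm_ofReal_sub (z : ℂ) (t : ℝ) : z.im ≤ ‖(t : ℂ) - z‖ := by
  have := Complex.abs_im_le_norm ((t : ℂ) - z)
  simp at this
  exact (le_abs_self _).trans this

lemma integrable_inv_ofReal_sub (μ : Measure ℝ) [IsFiniteMeasure μ] {z : ℂ} (hz : 0 < z.im) :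
    Integrable (fun t : ℝ ↦ ((t : ℂ) - z)⁻¹) μ := by
  refine Integrable.of_bound (Measurable.aestronglyMeasurable (by fun_prop)) z.im⁻¹
    (.of_forall fun t ↦ ?_)
  rw [norm_inv]
  exact inv_anti₀ hz (im_le_norm_ofReal_sub z t)

lemma nevanlinna_kernel_eq {z : ℂ} (hz : 0 < z.im) (t : ℝ) :
    (1 + (t : ℂ) * z) / ((t : ℂ) - z) = z + (1 + z ^ 2) * ((t : ℂ) - z)⁻¹ := by
  field_simp [ofReal_sub_ne_zero_of_im_pos hz t]
  ring

lemma integrable_nevanlinna_kernel (μ : Measure ℝ) [IsFiniteMeasure μ] {z : ℂ} (hz : 0 < z.im) :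
    Integrable (fun t : ℝ ↦ (1 + (t : ℂ) * z) / ((t : ℂ) - z)) μ := by
  simp_rw [nevanlinna_kernel_eq hz]
  exact (integrable_const _).add ((integrable_inv_ofReal_sub μ hz).const_mul _)

lemma integral_nevanlinna_kernel (μ : Measure ℝ) [IsFiniteMeasure μ] {z : ℂ} (hz : 0 < z.im) :
    ∫ t : ℝ, (1 + (t : ℂ) * z) / ((t : ℂ) - z) ∂μ =
      μ.real Set.univ * z + (1 + z ^ 2) * ∫ t : ℝ, ((t : ℂ) - z)⁻¹ ∂μ := by
  simp_rw [nevanlinna_kernel_eq hz]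
  rw [integral_add (integrable_const _) ((integrable_inv_ofReal_sub μ hz).const_mul _),
    integral_const_mul]
  simp

lemma im_nevanlinna_kernel (z : ℂ) (t : ℝ) :
    ((1 + (t : ℂ) * z) / ((t : ℂ) - z)).im = z.im * (1 + t ^ 2) / Complex.normSq ((t : ℂ) - z) := by
  simp [Complex.div_im]
  ring

lemma im_integral_nevanlinna_kernel (μ : Measure ℝ) [IsFiniteMeasure μ] {z : ℂ} (hz : 0 < z.im) :
    (∫ t : ℝ, (1 + (t : ℂ) * z) / ((t : ℂ) - z) ∂μ).im =
      ∫ t : ℝ, ((1 + (t : ℂ) * z) / ((t : ℂ) - z)).im ∂μ :=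
  (integral_im (𝕜 := ℂ) (integrable_nevanlinna_kernel μ hz)).symm

lemma differentiableOn_integral_inv_ofReal_sub (μ : Measure ℝ) [IsFiniteMeasure μ] :
    DifferentiableOn ℂ (fun z : ℂ ↦ ∫ t : ℝ, ((t : ℂ) - z)⁻¹ ∂μ) {z | 0 < z.im} := by
  intro z (hz : 0 < z.im)
  have key : ∀ x ∈ {x : ℂ | z.im / 2 < x.im}, 0 < x.im := fun x hx ↦ (half_pos hz).trans hx
  refine (hasDerivAt_integral_of_dominated_loc_of_deriv_le (μ := μ)
    (s := {x : ℂ | z.im / 2 < x.im}) (bound := fun _ ↦ ((z.im / 2) ^ 2)⁻¹)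
    (F' := fun x t ↦ (((t : ℂ) - x) ^ 2)⁻¹)
    ((isOpen_lt continuous_const Complex.continuous_im).mem_nhds (half_lt_self hz))
    (.of_forall fun x ↦ Measurable.aestronglyMeasurable (by fun_prop))
    (integrable_inv_ofReal_sub μ hz) (Measurable.aestronglyMeasurable (by fun_prop))
    (.of_forall fun t x hx ↦ ?_) (integrable_const _)
    (.of_forall fun t x hx ↦ ?_)).2.differentiableAt.differentiableWithinAt
  · rw [norm_inv, norm_pow]
    have h1 : z.im / 2 ≤ ‖(t : ℂ) - x‖ := (le_of_lt hx).trans (im_le_norm_ofReal_sub x t)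
    gcongr
  · have := ((hasDerivAt_id' x).const_sub (t : ℂ)).fun_inv
      (ofReal_sub_ne_zero_of_im_pos (key x hx) t)
    simpa using this

lemma differentiableOn_nevanlinna (b : ℝ) (μ : Measure ℝ) [IsFiniteMeasure μ] :
    DifferentiableOn ℂ (fun z : ℂ ↦ (b : ℂ) * z +
      ∫ t : ℝ, (1 + (t : ℂ) * z) / ((t : ℂ) - z) ∂μ) {z | 0 < z.im} := by
  have h := differentiableOn_integral_inv_ofReal_sub μ
  have : DifferentiableOn ℂ (fun z : ℂ ↦ (b : ℂ) * z + (μ.real Set.univ * z +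
      (1 + z ^ 2) * ∫ t : ℝ, ((t : ℂ) - z)⁻¹ ∂μ)) {z | 0 < z.im} := by
    fun_prop
  exact this.congr fun z hz ↦ by rw [integral_nevanlinna_kernel μ hz]

lemma im_nevanlinna_nonneg {a b : ℝ} (hb : 0 ≤ b) (μ : Measure ℝ) [IsFiniteMeasure μ]
    {z : ℂ} (hz : 0 < z.im) :
    0 ≤ ((a : ℂ) + (b : ℂ) * z + ∫ t : ℝ, (1 + (t : ℂ) * z) / ((t : ℂ) - z) ∂μ).im := by
  rw [Complex.add_im, im_integral_nevanlinna_kernel μ hz]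
  have : 0 ≤ ∫ t : ℝ, ((1 + (t : ℂ) * z) / ((t : ℂ) - z)).im ∂μ :=
    integral_nonneg fun t ↦ by
      simp only [Pi.zero_apply, im_nevanlinna_kernel]
      have := Complex.normSq_nonneg ((t : ℂ) - z)
      positivity
  simp
  positivity
lemma lintegral_mul_cauchyPDF {f : ℝ → ℝ≥0∞} (hf : Measurable f) (t : ℝ) {y : ℝ≥0} (hy : y ≠ 0) :
    ∫⁻ x, f x * ProbabilityTheory.cauchyPDF t y x =
      ∫⁻ s, f (t + y * s) * ProbabilityTheory.cauchyPDF 0 1 s := by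
  have hy' : (0 : ℝ) < y := by positivity
  have h1 : ∀ x, ENNReal.ofReal (y : ℝ) * ProbabilityTheory.cauchyPDF t y (t + y * x) =
      ProbabilityTheory.cauchyPDF 0 1 x := fun x ↦ by
    rw [ProbabilityTheory.cauchyPDF_def, ProbabilityTheory.cauchyPDF_def,
      ← ENNReal.ofReal_mul hy'.le]
    congr 1
    simp only [ProbabilityTheory.cauchyPDFReal_def]
    simp
    field
  have hg : Measurable fun x ↦ f (t + x) * ProbabilityTheory.cauchyPDF t y (t + x) := by fun_prop
  calc ∫⁻ x, f x * ProbabilityTheory.cauchyPDF t y x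
      = ∫⁻ x, f (t + x) * ProbabilityTheory.cauchyPDF t y (t + x) :=
        (lintegral_add_left_eq_self
          (fun x ↦ f x * ProbabilityTheory.cauchyPDF t y x) t).symm
    _ = ENNReal.ofReal (y : ℝ) *
          ∫⁻ x, f (t + y * x) * ProbabilityTheory.cauchyPDF t y (t + y * x) := by
        conv_lhs => rw [← Real.smul_map_volume_mul_left hy'.ne']
        rw [lintegral_smul_measure, lintegral_map hg (by fun_prop), abs_of_pos hy', smul_eq_mul]
    _ = _ := by
        rw [← lintegral_const_mul _ (by fun_prop)]
        congr with x
        rw [← h1 x]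
        ring

lemma tendsto_lintegral_lintegral_mul_cauchyPDF (μ : Measure ℝ) [IsFiniteMeasure μ]
    (f : ℝ →ᵇ ℝ≥0) :
    Filter.Tendsto (fun y : ℝ≥0 ↦ ∫⁻ t, (∫⁻ x, f x * ProbabilityTheory.cauchyPDF t y x) ∂μ)
      (𝓝[≠] 0) (𝓝 (∫⁻ t, f t ∂μ)) := by
  have hmass : ∫⁻ s, ProbabilityTheory.cauchyPDF 0 1 s = 1 :=
    ProbabilityTheory.lintegral_cauchyPDF_eq_one 0 one_ne_zero
  have hfm : Measurable fun x ↦ (f x : ℝ≥0∞) := f.continuous.measurable.coe_nnreal_ennreal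
  suffices h : Filter.Tendsto (fun y : ℝ≥0 ↦ ∫⁻ t, (∫⁻ s, f (t + y * s) *
      ProbabilityTheory.cauchyPDF 0 1 s) ∂μ) (𝓝[≠] 0) (𝓝 (∫⁻ t, f t ∂μ)) by
    refine h.congr' ?_
    filter_upwards [self_mem_nhdsWithin] with y hy
    simp_rw [lintegral_mul_cauchyPDF hfm _ hy]
  refine tendsto_lintegral_filter_of_dominated_convergence (fun _ ↦ (nndist f 0 : ℝ≥0∞))
    (.of_forall fun y ↦ ?_) (.of_forall fun y ↦ .of_forall fun t ↦ ?_)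
    (by simp [ENNReal.mul_eq_top]) (.of_forall fun t ↦ ?_)
  · exact Measurable.lintegral_prod_right' (f := fun p : ℝ × ℝ ↦
      (f (p.1 + y * p.2) : ℝ≥0∞) * ProbabilityTheory.cauchyPDF 0 1 p.2) (by fun_prop)
  · calc ∫⁻ s, f (t + y * s) * ProbabilityTheory.cauchyPDF 0 1 s
        ≤ ∫⁻ s, nndist f 0 * ProbabilityTheory.cauchyPDF 0 1 s := by
          gcongr with s
          exact BoundedContinuousFunction.NNReal.upper_bound f _
      _ = nndist f 0 := by rw [lintegral_const_mul _ (by fun_prop), hmass, mul_one]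
  · have : (f t : ℝ≥0∞) = ∫⁻ s, f t * ProbabilityTheory.cauchyPDF 0 1 s := by
      rw [lintegral_const_mul _ (by fun_prop), hmass, mul_one]
    rw [this]
    refine tendsto_lintegral_filter_of_dominated_convergence
      (fun s ↦ nndist f 0 * ProbabilityTheory.cauchyPDF 0 1 s)
      (.of_forall fun y ↦ by fun_prop) (.of_forall fun y ↦ .of_forall fun s ↦ ?_)
      (by rw [lintegral_const_mul _ (by fun_prop), hmass]; simp) (.of_forall fun s ↦ ?_)
    · gcongr
      exact BoundedContinuousFunction.NNReal.upper_bound f _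
    · refine ENNReal.Tendsto.mul_const ?_ (.inr ENNReal.ofReal_ne_top)
      refine ENNReal.tendsto_coe.2 ?_
      have hc : Continuous fun y : ℝ≥0 ↦ f (t + y * s) := by fun_prop
      simpa using (hc.tendsto 0).mono_left nhdsWithin_le_nhds

lemma lintegral_cauchyPDF_eq (μ : Measure ℝ) [IsFiniteMeasure μ] {y : ℝ≥0} (hy : y ≠ 0) (x : ℝ) :
    ∫⁻ t, ProbabilityTheory.cauchyPDF t y x ∂μ =
      ENNReal.ofReal (Real.pi⁻¹ * (∫ t : ℝ, ((t : ℂ) - (x + y * Complex.I))⁻¹ ∂μ).im) := by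
  have hz : 0 < ((x : ℂ) + (y : ℝ) * Complex.I).im := by simpa using pos_iff_ne_zero.2 hy
  have hint := integrable_inv_ofReal_sub μ hz
  have heq : ∀ t : ℝ, ProbabilityTheory.cauchyPDFReal t y x =
      Real.pi⁻¹ * (((t : ℂ) - (x + (y : ℝ) * Complex.I))⁻¹).im := fun t ↦ by
    rw [ProbabilityTheory.cauchyPDFReal_def, Complex.inv_im, Complex.normSq_apply]
    simp
    ring
  have him : (∫ t : ℝ, ((t : ℂ) - (x + (y : ℝ) * Complex.I))⁻¹ ∂μ).im =
      ∫ t : ℝ, (((t : ℂ) - (x + (y : ℝ) * Complex.I))⁻¹).im ∂μ :=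
    (integral_im (𝕜 := ℂ) hint).symm
  rw [him, ← integral_const_mul]
  simp_rw [← heq, ProbabilityTheory.cauchyPDF_def]
  refine (ofReal_integral_eq_lintegral_ofReal ?_ (.of_forall fun t ↦
    (ProbabilityTheory.cauchyPDF_pos t hy x).le)).symm
  simp_rw [heq]
  exact hint.im.const_mul _

lemma lintegral_lintegral_mul_swap {α β : Type*} [MeasurableSpace α] [MeasurableSpace β]
    (μ : Measure α) (ν : Measure β) [SFinite μ] [SFinite ν] {f : β → ℝ≥0∞} {k : α → β → ℝ≥0∞}
    (hf : Measurable f) (hk : Measurable (Function.uncurry k)) :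
    ∫⁻ t, ∫⁻ x, f x * k t x ∂ν ∂μ = ∫⁻ x, f x * ∫⁻ t, k t x ∂μ ∂ν := by
  rw [lintegral_lintegral_swap ((hf.comp measurable_snd).mul hk).aemeasurable]
  exact lintegral_congr fun x ↦ lintegral_const_mul _ hk.of_uncurry_right

lemma measurable_uncurry_cauchyPDF (y : ℝ≥0) :
    Measurable (Function.uncurry fun t x ↦ ProbabilityTheory.cauchyPDF t y x) := by
  simp only [Function.uncurry_def, ProbabilityTheory.cauchyPDF_def,
    ProbabilityTheory.cauchyPDFReal_def]
  fun_prop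

lemma ext_of_integral_inv_ofReal_sub {μ₁ μ₂ : Measure ℝ} [IsFiniteMeasure μ₁] [IsFiniteMeasure μ₂]
    (h : ∀ z : ℂ, 0 < z.im → z.im < 1 →
      ∫ t : ℝ, ((t : ℂ) - z)⁻¹ ∂μ₁ = ∫ t : ℝ, ((t : ℂ) - z)⁻¹ ∂μ₂) : μ₁ = μ₂ := by
  refine ext_of_forall_lintegral_eq_of_IsFiniteMeasure fun f ↦ ?_
  have hfm : Measurable fun x ↦ (f x : ℝ≥0∞) := f.continuous.measurable.coe_nnreal_ennreal
  refine tendsto_nhds_unique (tendsto_lintegral_lintegral_mul_cauchyPDF μ₁ f)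
    ((tendsto_lintegral_lintegral_mul_cauchyPDF μ₂ f).congr' ?_)
  have h1 : ∀ᶠ y : ℝ≥0 in 𝓝[≠] 0, y < 1 :=
    nhdsWithin_le_nhds (Iio_mem_nhds zero_lt_one)
  filter_upwards [self_mem_nhdsWithin, h1] with y hy hy1
  rw [lintegral_lintegral_mul_swap _ _ hfm (measurable_uncurry_cauchyPDF y),
    lintegral_lintegral_mul_swap _ _ hfm (measurable_uncurry_cauchyPDF y)]
  refine lintegral_congr fun x ↦ ?_
  rw [lintegral_cauchyPDF_eq μ₁ hy, lintegral_cauchyPDF_eq μ₂ hy,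
    h _ (by simpa using pos_iff_ne_zero.2 hy) (by simpa using hy1)]

lemma norm_cayley_lt_one {z : ℂ} (hz : 0 < z.im) :
    ‖(z - Complex.I) / (z + Complex.I)‖ < 1 := by
  have h : ‖z - Complex.I‖ ^ 2 < ‖z + Complex.I‖ ^ 2 := by
    rw [← Complex.normSq_eq_norm_sq, ← Complex.normSq_eq_norm_sq, Complex.normSq_apply,
      Complex.normSq_apply]
    simp
    nlinarith
  have h' := lt_of_pow_lt_pow_left₀ 2 (norm_nonneg _) h
  rw [norm_div, div_lt_one ((norm_nonneg _).trans_lt h')]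
  exact h'

open Metric in
/-- Poisson formula on the unit circle for a dilate of `f`. -/
lemma re_dilate_eq_integral {f : ℂ → ℂ} (hf : DifferentiableOn ℂ f (ball 0 1)) {r : ℝ}
    (hr0 : 0 < r) (hr1 : r < 1) {w : ℂ} (hw : w ∈ ball (0 : ℂ) 1) :
    (f (r * w)).re = (2 * Real.pi)⁻¹ * ∫ θ in Set.Ioc 0 (2 * Real.pi),
      ((circleMap 0 1 θ + w) / (circleMap 0 1 θ - w)).re * (f (r * circleMap 0 1 θ)).re := by
  have hmaps : ∀ x ∈ closedBall (0 : ℂ) 1, (r : ℂ) * x ∈ ball (0 : ℂ) 1 := fun x hx ↦ by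
    simp only [mem_closedBall, dist_zero_right, mem_ball, norm_mul, Complex.norm_real,
      Real.norm_eq_abs, abs_of_pos hr0] at hx ⊢
    nlinarith [norm_nonneg x]
  have hd : DiffContOnCl ℂ (fun x ↦ f (r * x)) (ball 0 1) := by
    refine DifferentiableOn.diffContOnCl ?_
    rw [closure_ball _ one_ne_zero]
    exact hf.comp (by fun_prop) hmaps
  have hP := hd.circleAverage_re_herglotzRieszKernel_smul' hw
  have hcont : ContinuousOn (fun z : ℂ ↦ ((z - 0 + (w - 0)) / ((z - 0) - (w - 0))).re • f (r * z))
      (sphere 0 1) := by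
    refine ContinuousOn.smul (Complex.continuous_re.comp_continuousOn ?_)
      (hd.continuousOn.mono (by rw [closure_ball _ one_ne_zero]; exact sphere_subset_closedBall))
    refine ContinuousOn.div (by fun_prop) (by fun_prop) fun z hz h ↦ ?_
    rw [sub_zero, sub_zero, sub_eq_zero] at h
    subst h
    simp at hz hw
    linarith
  have h2 := Complex.reCLM.circleAverage_comp_comm (hcont.circleIntegrable zero_le_one)
  rw [hP] at h2
  simp only [Complex.reCLM_apply] at h2
  rw [← h2, Real.circleAverage_def, intervalIntegral.integral_of_le Real.two_pi_pos.le]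
  simp

open Metric in
/-- **Herglotz representation** of the real part. -/
lemma exists_measure_sphere_re_eq_integral {f : ℂ → ℂ} (hf : DifferentiableOn ℂ f (ball 0 1))
    (hpos : ∀ w ∈ ball (0 : ℂ) 1, 0 ≤ (f w).re) :
    ∃ ν : Measure (sphere (0 : ℂ) 1), IsFiniteMeasure ν ∧ ∀ w ∈ ball (0 : ℂ) 1,
      (f w).re = ∫ ζ, (((ζ : ℂ) + w) / ((ζ : ℂ) - w)).re ∂ν := by
  let e : ℝ → sphere (0 : ℂ) 1 := fun θ ↦ ⟨circleMap 0 1 θ, circleMap_mem_sphere 0 zero_le_one θ⟩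
  have he : Measurable e := by fun_prop
  let G : ℝ → ℝ → ℝ := fun r θ ↦ (2 * Real.pi)⁻¹ * (f (r * circleMap 0 1 θ)).re
  let m : Measure ℝ := volume.restrict (Set.Ioc 0 (2 * Real.pi))
  have hmem : ∀ r ∈ Set.Ioo (0 : ℝ) 1, ∀ θ, (r : ℂ) * circleMap 0 1 θ ∈ ball (0 : ℂ) 1 :=
    fun r hr θ ↦ by simpa [abs_of_pos hr.1] using hr.2
  have hG0 : ∀ r ∈ Set.Ioo (0 : ℝ) 1, ∀ θ, 0 ≤ G r θ := fun r hr θ ↦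
    mul_nonneg (by positivity) (hpos _ (hmem r hr θ))
  have hGc : ∀ r ∈ Set.Ioo (0 : ℝ) 1, Continuous (G r) := fun r hr ↦
    continuous_const.mul <| Complex.continuous_re.comp <|
      hf.continuousOn.comp_continuous (by fun_prop) (hmem r hr)
  let M : ℝ → Measure (sphere (0 : ℂ) 1) := fun r ↦
    (m.withDensity fun θ ↦ ENNReal.ofReal (G r θ)).map e
  have hint : ∀ r ∈ Set.Ioo (0 : ℝ) 1, ∀ g : C(sphere (0 : ℂ) 1, ℝ),
      ∫ ζ, g ζ ∂(M r) = ∫ θ, G r θ * g (e θ) ∂m := fun r hr g ↦ by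
    rw [integral_map he.aemeasurable g.continuous.aestronglyMeasurable,
      integral_withDensity_eq_integral_toReal_smul (hGc r hr).measurable.ennreal_ofReal (by simp)]
    simp [ENNReal.toReal_ofReal (hG0 r hr _)]
  have hmass : ∀ r ∈ Set.Ioo (0 : ℝ) 1, M r Set.univ = ENNReal.ofReal (f 0).re := fun r hr ↦ by
    rw [Measure.map_apply he .univ, Set.preimage_univ, withDensity_apply _ .univ,
      Measure.restrict_univ, ← ofReal_integral_eq_lintegral_ofReal
        (((hGc r hr).integrableOn_Icc).mono_set Set.Ioc_subset_Icc_self)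
        (.of_forall (hG0 r hr))]
    congr 1
    have := re_dilate_eq_integral hf hr.1 hr.2 (w := 0) (by simp)
    simp only [mul_zero] at this
    rw [this, ← integral_const_mul]
    refine integral_congr_ae (.of_forall fun θ ↦ ?_)
    simp [G, circleMap]
  classical
  let N : ℝ → FiniteMeasure (sphere (0 : ℂ) 1) := fun r ↦
    if h : IsFiniteMeasure (M r) then ⟨M r, h⟩ else 0
  have hN : ∀ r ∈ Set.Ioo (0 : ℝ) 1, (N r : Measure (sphere (0 : ℂ) 1)) = M r := fun r hr ↦ by
    have : IsFiniteMeasure (M r) := ⟨by rw [hmass r hr]; exact ENNReal.ofReal_lt_top⟩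
    simp [N, this]
  have hIoo : ∀ᶠ r in 𝓝[<] (1 : ℝ), r ∈ Set.Ioo (0 : ℝ) 1 := Ioo_mem_nhdsLT zero_lt_one
  let F : Ultrafilter ℝ := Ultrafilter.of (𝓝[<] (1 : ℝ))
  have hF : (F : Filter ℝ) ≤ 𝓝[<] 1 := Ultrafilter.of_le _
  have hNmem : {μ : FiniteMeasure (sphere (0 : ℂ) 1) | μ.mass ≤ (f 0).re.toNNReal} ∈ F.map N := by
    rw [Ultrafilter.mem_map]
    refine hF ?_
    filter_upwards [hIoo] with r hr
    rw [Set.mem_preimage, Set.mem_ofPred_eq, ← ENNReal.coe_le_coe, FiniteMeasure.ennreal_mass, hN r hr,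
      hmass r hr]
    rfl
  obtain ⟨ν, -, hν⟩ := (isCompact_setOfPred_finiteMeasure_le_of_compactSpace
    (sphere (0 : ℂ) 1) (f 0).re.toNNReal).ultrafilter_le_nhds' _ hNmem
  refine ⟨ν, inferInstance, fun w hw ↦ ?_⟩
  have hne : ∀ ζ : sphere (0 : ℂ) 1, (ζ : ℂ) - w ≠ 0 := fun ζ h ↦ by
    have h1 : ‖(ζ : ℂ)‖ = 1 := by simp
    rw [sub_eq_zero.1 h] at h1
    simp at hw
    linarith
  let g : C(sphere (0 : ℂ) 1, ℝ) := ⟨fun ζ ↦ (((ζ : ℂ) + w) / ((ζ : ℂ) - w)).re,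
    Complex.continuous_re.comp (Continuous.div (by fun_prop) (by fun_prop) hne)⟩
  have hlim : Filter.Tendsto (fun r ↦ ∫ ζ, g ζ ∂(N r : Measure (sphere (0 : ℂ) 1))) F
      (𝓝 (∫ ζ, g ζ ∂(ν : Measure (sphere (0 : ℂ) 1)))) :=
    FiniteMeasure.tendsto_iff_forall_integral_tendsto.1 hν
      (BoundedContinuousFunction.mkOfCompact g)
  have hlim' : Filter.Tendsto (fun r : ℝ ↦ (f (r * w)).re) (𝓝[<] 1) (𝓝 (f w).re) := by
    have h1 : ContinuousAt f ((1 : ℝ) * w) := by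
      simpa using hf.continuousOn.continuousAt (isOpen_ball.mem_nhds hw)
    have h2 : ContinuousAt (fun r : ℝ ↦ (f (r * w)).re) 1 :=
      Complex.continuous_re.continuousAt.comp
        (ContinuousAt.comp (f := fun r : ℝ ↦ (r : ℂ) * w) h1 (by fun_prop))
    simpa using h2.tendsto.mono_left nhdsWithin_le_nhds
  refine tendsto_nhds_unique ((hlim'.mono_left hF).congr' ?_) hlim
  refine Filter.Eventually.filter_mono hF ?_
  filter_upwards [hIoo] with r hr
  rw [hN r hr, hint r hr, re_dilate_eq_integral hf hr.1 hr.2 hw, ← integral_const_mul]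
  refine integral_congr_ae (.of_forall fun θ ↦ ?_)
  simp only [g, G, e, ContinuousMap.coe_mk]
  ring

lemma nevanlinna_kernel_cayley {z ζ : ℂ} (hz : 0 < z.im) (hζ : ‖ζ‖ = 1) (h1 : ζ ≠ 1) :
    ((ζ + (z - Complex.I) / (z + Complex.I)) / (ζ - (z - Complex.I) / (z + Complex.I))).re =
      ((1 + ((Complex.I * (1 + ζ) / (1 - ζ)).re : ℂ) * z) /
        (((Complex.I * (1 + ζ) / (1 - ζ)).re : ℂ) - z)).im := by
  have h1' : 1 - ζ ≠ 0 := sub_ne_zero.2 h1.symm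
  have hzI : z + Complex.I ≠ 0 := fun h ↦ by
    have := congrArg Complex.im h
    simp at this
    linarith
  have him : (Complex.I * (1 + ζ) / (1 - ζ)).im = 0 := by
    have hsq : ζ.re * ζ.re + ζ.im * ζ.im = 1 := by
      rw [← Complex.normSq_apply, Complex.normSq_eq_norm_sq, hζ, one_pow]
    simp only [Complex.div_im, Complex.mul_re, Complex.mul_im, Complex.add_re, Complex.add_im,
      Complex.sub_re, Complex.sub_im, Complex.one_re, Complex.one_im, Complex.I_re, Complex.I_im]
    linear_combination (-(Complex.normSq (1 - ζ))⁻¹) * hsq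
  have ht : ((Complex.I * (1 + ζ) / (1 - ζ)).re : ℂ) = Complex.I * (1 + ζ) / (1 - ζ) := by
    apply Complex.ext <;> simp [him]
  have htz := ofReal_sub_ne_zero_of_im_pos hz (Complex.I * (1 + ζ) / (1 - ζ)).re
  rw [ht] at htz ⊢
  have hden : ζ - (z - Complex.I) / (z + Complex.I) ≠ 0 := by
    have : ζ - (z - Complex.I) / (z + Complex.I) =
        (Complex.I * (1 + ζ) / (1 - ζ) - z) * (1 - ζ) / (z + Complex.I) := by
      field_simp
      ring
    rw [this]
    exact div_ne_zero (mul_ne_zero htz h1') hzI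
  have key : Complex.I * ((ζ + (z - Complex.I) / (z + Complex.I)) /
      (ζ - (z - Complex.I) / (z + Complex.I))) =
      (1 + Complex.I * (1 + ζ) / (1 - ζ) * z) / (Complex.I * (1 + ζ) / (1 - ζ) - z) := by
    rw [mul_div_assoc', div_eq_div_iff hden htz]
    field_simp
    ring_nf
    simp [Complex.I_sq, Complex.I_pow_three]
    ring
  rw [← key]
  simp

open Metric in
lemma exists_re_integral_sphere_cayley_eq (ν : Measure (sphere (0 : ℂ) 1)) [IsFiniteMeasure ν] :
    ∃ (b : ℝ) (μ : Measure ℝ), 0 ≤ b ∧ IsFiniteMeasure μ ∧ ∀ z : ℂ, 0 < z.im →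
      ∫ ζ, (((ζ : ℂ) + (z - Complex.I) / (z + Complex.I)) /
          ((ζ : ℂ) - (z - Complex.I) / (z + Complex.I))).re ∂ν =
        ((b : ℂ) * z + ∫ t : ℝ, (1 + (t : ℂ) * z) / ((t : ℂ) - z) ∂μ).im := by
  let p : sphere (0 : ℂ) 1 := ⟨1, by simp⟩
  let T : sphere (0 : ℂ) 1 → ℝ := fun ζ ↦ (Complex.I * (1 + (ζ : ℂ)) / (1 - (ζ : ℂ))).re
  have hT : Measurable T := by fun_prop
  refine ⟨ν.real {p}, (ν.restrict {p}ᶜ).map T, measureReal_nonneg, inferInstance, fun z hz ↦ ?_⟩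
  have hzI : z + Complex.I ≠ 0 := fun h ↦ by
    have := congrArg Complex.im h
    simp at this
    linarith
  have hne : ∀ ζ : sphere (0 : ℂ) 1, (ζ : ℂ) - (z - Complex.I) / (z + Complex.I) ≠ 0 :=
    fun ζ h ↦ by
    have h1 : ‖(ζ : ℂ)‖ = 1 := by simp
    have := norm_cayley_lt_one hz
    rw [← sub_eq_zero.1 h] at this
    linarith
  have hint : Integrable (fun ζ : sphere (0 : ℂ) 1 ↦
      (((ζ : ℂ) + (z - Complex.I) / (z + Complex.I)) /
        ((ζ : ℂ) - (z - Complex.I) / (z + Complex.I))).re) ν := by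
    have hc : Continuous fun ζ : sphere (0 : ℂ) 1 ↦
      (((ζ : ℂ) + (z - Complex.I) / (z + Complex.I)) /
        ((ζ : ℂ) - (z - Complex.I) / (z + Complex.I))).re :=
      Complex.continuous_re.comp (Continuous.div (by fun_prop) (by fun_prop) hne)
    exact hc.integrable_of_hasCompactSupport (.of_compactSpace _)
  rw [Complex.add_im, im_integral_nevanlinna_kernel _ hz,
    ← integral_add_compl (measurableSet_singleton p) hint, integral_singleton,
    integral_map hT.aemeasurable (Measurable.aestronglyMeasurable (by fun_prop))]
  congr 1
  · have : ((1 : ℂ) + (z - Complex.I) / (z + Complex.I)) /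
        (1 - (z - Complex.I) / (z + Complex.I)) = -Complex.I * z := by
      have h2 := hne p
      change (1 : ℂ) - _ ≠ 0 at h2
      rw [div_eq_iff h2]
      field_simp
      ring_nf
      simp [Complex.I_sq]
    simp [p, this]
  · refine setIntegral_congr_fun (measurableSet_singleton p).compl fun ζ hζ ↦ ?_
    exact nevanlinna_kernel_cayley hz (by simp) fun h ↦ hζ (Subtype.ext h)

lemma exists_nevanlinna_representation {h : ℂ → ℂ} (hd : DifferentiableOn ℂ h {z : ℂ | 0 < z.im})
    (hpos : ∀ z : ℂ, 0 < z.im → 0 ≤ (h z).im) :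
    ∃ (a b : ℝ) (μ : Measure ℝ), 0 ≤ b ∧ IsFiniteMeasure μ ∧ ∀ z : ℂ, 0 < z.im →
      h z = (a : ℂ) + (b : ℂ) * z + ∫ t : ℝ, (1 + (t : ℂ) * z) / ((t : ℂ) - z) ∂μ := by
  have hw1 : ∀ w ∈ Metric.ball (0 : ℂ) 1, 1 - w ≠ 0 := fun w hw h ↦ by
    rw [← sub_eq_zero.1 h] at hw
    simp at hw
  have hC : ∀ w ∈ Metric.ball (0 : ℂ) 1, 0 < (Complex.I * (1 + w) / (1 - w)).im := fun w hw ↦ by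
    have hsq : w.re * w.re + w.im * w.im < 1 := by
      rw [← Complex.normSq_apply, Complex.normSq_eq_norm_sq]
      have : ‖w‖ < 1 := by simpa using hw
      nlinarith [norm_nonneg w]
    have : (Complex.I * (1 + w) / (1 - w)).im =
        (1 - (w.re * w.re + w.im * w.im)) / Complex.normSq (1 - w) := by
      simp [Complex.div_im]
      ring
    rw [this]
    exact div_pos (by linarith) (Complex.normSq_pos.2 (hw1 w hw))
  obtain ⟨ν, _, hν⟩ := exists_measure_sphere_re_eq_integral
    (f := fun w ↦ -Complex.I * h (Complex.I * (1 + w) / (1 - w)))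
    ((hd.comp (DifferentiableOn.div (by fun_prop) (by fun_prop) hw1) hC).const_mul _)
    (fun w hw ↦ by simpa using hpos _ (hC w hw))
  obtain ⟨b, μ, hb, hμ, hbμ⟩ := exists_re_integral_sphere_cayley_eq ν
  have hopen : IsOpen {z : ℂ | 0 < z.im} := isOpen_lt continuous_const Complex.continuous_im
  have him : ∀ z ∈ {z : ℂ | 0 < z.im}, (h z - ((b : ℂ) * z +
      ∫ t : ℝ, (1 + (t : ℂ) * z) / ((t : ℂ) - z) ∂μ)).im = 0 := fun z hz ↦ by
    have hzI : z + Complex.I ≠ 0 := fun h ↦ by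
      have := congrArg Complex.im h
      have hz' : 0 < z.im := hz
      simp at this
      linarith
    have := hν ((z - Complex.I) / (z + Complex.I)) (by simpa using norm_cayley_lt_one hz)
    have hinv : Complex.I * (1 + (z - Complex.I) / (z + Complex.I)) /
        (1 - (z - Complex.I) / (z + Complex.I)) = z := by
      have h2 : 1 - (z - Complex.I) / (z + Complex.I) ≠ 0 :=
        hw1 _ (by simpa using norm_cayley_lt_one hz)
      rw [div_eq_iff h2]
      field_simp
      ring_nf
    rw [Complex.sub_im, ← hbμ z hz, ← this, hinv]
    simp
  obtain ⟨a, ha⟩ := AnalyticOnNhd.eq_const_add_im_mul_I_of_re_eq_const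
    ((hd.sub (differentiableOn_nevanlinna b μ)).analyticOnNhd hopen) him hopen
    ((convex_halfSpace_im_gt 0).isConnected ⟨Complex.I, by simp⟩)
  refine ⟨a, b, μ, hb, hμ, fun z hz ↦ ?_⟩
  have := ha z hz
  simp only [Pi.sub_apply, Complex.ofReal_zero, zero_mul, add_zero] at this
  linear_combination this

lemma nevanlinna_representation_unique {a₁ b₁ a₂ b₂ : ℝ} {μ₁ μ₂ : Measure ℝ}
    [IsFiniteMeasure μ₁] [IsFiniteMeasure μ₂]
    (h : ∀ z : ℂ, 0 < z.im →
      (a₁ : ℂ) + (b₁ : ℂ) * z + ∫ t : ℝ, (1 + (t : ℂ) * z) / ((t : ℂ) - z) ∂μ₁ =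
        (a₂ : ℂ) + (b₂ : ℂ) * z + ∫ t : ℝ, (1 + (t : ℂ) * z) / ((t : ℂ) - z) ∂μ₂) :
    a₁ = a₂ ∧ b₁ = b₂ ∧ μ₁ = μ₂ := by
  have h' : ∀ z : ℂ, 0 < z.im →
      (a₁ : ℂ) + (b₁ + μ₁.real Set.univ) * z + (1 + z ^ 2) * ∫ t : ℝ, ((t : ℂ) - z)⁻¹ ∂μ₁ =
        (a₂ : ℂ) + (b₂ + μ₂.real Set.univ) * z + (1 + z ^ 2) * ∫ t : ℝ, ((t : ℂ) - z)⁻¹ ∂μ₂ :=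
    fun z hz ↦ by
    have := h z hz
    rw [integral_nevanlinna_kernel μ₁ hz, integral_nevanlinna_kernel μ₂ hz] at this
    linear_combination this
  have hI := h' Complex.I (by simp)
  simp only [Complex.I_sq, add_neg_cancel, zero_mul, add_zero] at hI
  have ha : a₁ = a₂ := by simpa using congrArg Complex.re hI
  have hb : b₁ + μ₁.real Set.univ = b₂ + μ₂.real Set.univ := by
    simpa using congrArg Complex.im hI
  have hμ : μ₁ = μ₂ := ext_of_integral_inv_ofReal_sub fun z hz hz1 ↦ by
    have hne : 1 + z ^ 2 ≠ 0 := fun h0 ↦ by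
      have hfac : (z - Complex.I) * (z + Complex.I) = 0 := by
        linear_combination h0 - Complex.I_sq
      rcases mul_eq_zero.1 hfac with h1 | h1 <;>
      · have := congrArg Complex.im h1
        simp at this
        linarith
    refine mul_left_cancel₀ hne ?_
    have hb' : (b₁ : ℂ) + μ₁.real Set.univ = b₂ + μ₂.real Set.univ := by exact_mod_cast hb
    have := h' z hz
    rw [ha, hb'] at this
    exact add_left_cancel this
  subst hμ
  exact ⟨ha, add_right_cancel hb, rfl⟩

end

/-- Nevanlinna's representation theorem (one variable): `h` is a Pick function
(holomorphic with nonnegative imaginary part on the upper half plane) if and only if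
there exist `a ∈ ℝ`, `b ≥ 0` and a finite positive Borel measure `μ` on `ℝ` with
`h(z) = a + bz + ∫ (1 + tz)/(t − z) dμ(t)` on the upper half plane; moreover `a`, `b`
and `μ` are uniquely determined by `h`. -/
theorem nevanlinna_full_representation (h : ℂ → ℂ) :
    ((DifferentiableOn ℂ h {z : ℂ | 0 < z.im} ∧
        ∀ z : ℂ, 0 < z.im → 0 ≤ (h z).im) ↔
      (∃ (a b : ℝ) (μ : Measure ℝ), 0 ≤ b ∧ IsFiniteMeasure μ ∧
        ∀ z : ℂ, 0 < z.im →
          h z = (a : ℂ) + (b : ℂ) * z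
            + ∫ t : ℝ, (1 + (t : ℂ) * z) / ((t : ℂ) - z) ∂μ)) ∧
    (∀ (a₁ b₁ a₂ b₂ : ℝ) (μ₁ μ₂ : Measure ℝ),
      0 ≤ b₁ → 0 ≤ b₂ → IsFiniteMeasure μ₁ → IsFiniteMeasure μ₂ →
      (∀ z : ℂ, 0 < z.im →
        h z = (a₁ : ℂ) + (b₁ : ℂ) * z
          + ∫ t : ℝ, (1 + (t : ℂ) * z) / ((t : ℂ) - z) ∂μ₁) →
      (∀ z : ℂ, 0 < z.im →
        h z = (a₂ : ℂ) + (b₂ : ℂ) * z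
          + ∫ t : ℝ, (1 + (t : ℂ) * z) / ((t : ℂ) - z) ∂μ₂) →
      a₁ = a₂ ∧ b₁ = b₂ ∧ μ₁ = μ₂) := by
  refine ⟨⟨fun ⟨hd, hpos⟩ ↦ exists_nevanlinna_representation hd hpos, ?_⟩, ?_⟩
  · rintro ⟨a, b, μ, hb, hμ, hh⟩
    refine ⟨?_, fun z hz ↦ ?_⟩
    · exact ((differentiableOn_nevanlinna b μ).const_add (a : ℂ)).congr fun z hz ↦ by
        rw [hh z hz, add_assoc]
    · rw [hh z hz]
      exact im_nevanlinna_nonneg hb μ hz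
  · intro a₁ b₁ a₂ b₂ μ₁ μ₂ _ _ _ _ h₁ h₂
    exact nevanlinna_representation_unique fun z hz ↦ (h₁ z hz).symm.trans (h₂ z hz)
end

section
/- Let (ρ_i)_{i≥0} be a sequence of real numbers. Then there exists a finite positive Borel measure μ on ℝ such that ρ_i = ∫_ℝ t^i dμ(t) for every i ∈ ℕ (in particular t ↦ t^i is μ-integrable for every i), if and only if for every N ∈ ℕ the truncated Hankel matrix [ρ_{i+j}]_{0 ≤ i,j ≤ N} is positive semidefinite. -/
open MeasureTheory
open scoped ComplexOrder

namespace HamburgerMoment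

open Polynomial Filter Topology
open scoped CompactlySupported

/-- A real polynomial that is nonnegative on `ℝ` is a sum of squares. -/
theorem isSumSq_of_eval_nonneg (p : ℝ[X]) (hp : ∀ t, 0 ≤ p.eval t) : IsSumSq p := by
  induction hn : p.natDegree using Nat.strong_induction_on generalizing p with
  | _ n ih =>
    obtain ⟨a, ha⟩ := p.exists_forall_norm_le
    replace ha : ∀ t, p.eval a ≤ p.eval t := fun t => by
      simpa [abs_of_nonneg (hp _)] using ha t
    have hC : IsSumSq (C (p.eval a)) := by
      rw [← Real.mul_self_sqrt (hp a), C_mul]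
      exact IsSumSq.mul_self _
    by_cases h0 : p - C (p.eval a) = 0
    · rw [sub_eq_zero.1 h0]
      exact hC
    have hmin : IsLocalMin (fun t => (p - C (p.eval a)).eval t) a :=
      Eventually.of_forall fun t => by simpa using ha t
    have hroot : 1 < (p - C (p.eval a)).rootMultiplicity a :=
      (one_lt_rootMultiplicity_iff_isRoot h0).2
        ⟨by simp, by rw [IsRoot, ← Polynomial.deriv]; exact hmin.deriv_eq_zero⟩
    obtain ⟨q, hq⟩ := (le_rootMultiplicity_iff h0).1 hroot
    have hq0 : q ≠ 0 := by
      rintro rfl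
      exact h0 (by simpa using hq)
    have hX : ((X - C a) ^ (1 + 1)).natDegree = 2 := by simp
    have hdeg : p.natDegree = 2 + q.natDegree := by
      rw [← natDegree_sub_C (a := p.eval a), hq, natDegree_mul (by simp [X_sub_C_ne_zero]) hq0, hX]
    have hqpos : ∀ t, 0 ≤ q.eval t := by
      have hne : ∀ t ∈ ({a}ᶜ : Set ℝ), 0 ≤ q.eval t := fun t ht => by
        have h := congrArg (eval t) hq
        simp only [eval_sub, eval_C, eval_mul, eval_pow, eval_X] at h
        have hta : 0 < (t - a) ^ (1 + 1) := by
          exact even_two.pow_pos (sub_ne_zero.2 ht)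
        exact nonneg_of_mul_nonneg_right (h ▸ sub_nonneg.2 (ha t)) hta
      intro t
      exact (isClosed_le continuous_const q.continuous).closure_subset_iff.2 hne
        (dense_compl_singleton a t)
    rw [← sub_add_cancel p (C (p.eval a)), hq, pow_succ, pow_one]
    exact ((IsSumSq.mul_self _).mul (ih _ (by omega) q hqpos rfl)).add hC

/-- The continuous cutoff equal to `1` on `[-n, n]` and to `0` outside `[-n - 1, n + 1]`. -/
noncomputable def cutoff (n : ℕ) (t : ℝ) : ℝ := max 0 (min 1 (n + 1 - |t|))

theorem continuous_cutoff (n : ℕ) : Continuous (cutoff n) := by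
  unfold cutoff
  fun_prop

theorem cutoff_nonneg (n : ℕ) (t : ℝ) : 0 ≤ cutoff n t := le_max_left _ _

theorem cutoff_le_one (n : ℕ) (t : ℝ) : cutoff n t ≤ 1 :=
  max_le zero_le_one (min_le_left _ _)

theorem cutoff_eq_one {n : ℕ} {t : ℝ} (h : |t| ≤ n) : cutoff n t = 1 := by
  rw [cutoff, min_eq_left (by linarith), max_eq_right zero_le_one]

theorem hasCompactSupport_cutoff (n : ℕ) : HasCompactSupport (cutoff n) := by
  refine HasCompactSupport.intro (isCompact_closedBall (0 : ℝ) (n + 1)) fun t ht => ?_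
  rw [Metric.mem_closedBall, dist_zero_right, Real.norm_eq_abs, not_le] at ht
  exact max_eq_left ((min_le_right _ _).trans (by linarith))

theorem tendsto_cutoff (t : ℝ) : Tendsto (fun n => cutoff n t) atTop (𝓝 1) := by
  obtain ⟨N, hN⟩ := exists_nat_ge |t|
  refine tendsto_const_nhds.congr' ?_
  filter_upwards [eventually_ge_atTop N] with n hn
  exact (cutoff_eq_one (hN.trans (by exact_mod_cast hn))).symm

/-- The real functions on `ℝ` that are bounded in absolute value by a polynomial. -/
def polyBounded : Submodule ℝ (ℝ → ℝ) where
  carrier := {f | ∃ p : ℝ[X], ∀ t, |f t| ≤ p.eval t}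
  zero_mem' := ⟨0, by simp⟩
  add_mem' := by
    rintro f g ⟨p, hp⟩ ⟨q, hq⟩
    refine ⟨p + q, fun t => (abs_add_le _ _).trans ?_⟩
    rw [eval_add]
    exact add_le_add (hp t) (hq t)
  smul_mem' := by
    rintro c f ⟨p, hp⟩
    refine ⟨C |c| * p, fun t => ?_⟩
    rw [Pi.smul_apply, smul_eq_mul, abs_mul, eval_mul, eval_C]
    exact mul_le_mul_of_nonneg_left (hp t) (abs_nonneg c)

theorem abs_le_one_add_sq (x : ℝ) : |x| ≤ 1 + x ^ 2 := by
  rw [← sq_abs]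
  nlinarith [sq_nonneg (|x| - 1)]

theorem eval_mem_polyBounded (p : ℝ[X]) : (fun t => p.eval t) ∈ polyBounded :=
  ⟨1 + p ^ 2, fun t => by simpa using abs_le_one_add_sq (p.eval t)⟩

theorem mem_polyBounded_of_compactlySupported (f : C_c(ℝ, ℝ)) : (f : ℝ → ℝ) ∈ polyBounded := by
  obtain ⟨c, hc⟩ := f.hasCompactSupport.exists_bound_of_continuous f.continuous
  exact ⟨C c, fun t => by simpa using hc t⟩

/-- Polynomials as polynomially bounded functions. -/
noncomputable def polyEval : ℝ[X] →ₗ[ℝ] polyBounded where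
  toFun p := ⟨fun t => p.eval t, eval_mem_polyBounded p⟩
  map_add' p q := by ext; simp
  map_smul' c p := by ext; simp

theorem polyEval_injective : Function.Injective polyEval := fun _ _ h =>
  Polynomial.funext fun t => congrFun (congrArg Subtype.val h) t

/-- A functional on polynomials that is nonnegative on nonnegative polynomials extends to a positive
functional on polynomially bounded functions. -/
theorem exists_extension (L : ℝ[X] →ₗ[ℝ] ℝ) (hL : ∀ p : ℝ[X], (∀ t, 0 ≤ p.eval t) → 0 ≤ L p) :
    ∃ g : polyBounded →ₗ[ℝ] ℝ, (∀ p, g (polyEval p) = L p) ∧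
      ∀ f : polyBounded, (∀ t, 0 ≤ (f : ℝ → ℝ) t) → 0 ≤ g f := by
  let e := LinearEquiv.ofInjective polyEval polyEval_injective
  let s : PointedCone ℝ polyBounded :=
    (PointedCone.positive ℝ (ℝ → ℝ)).comap polyBounded.subtype
  have hs : ∀ f : polyBounded, f ∈ s ↔ ∀ t, 0 ≤ (f : ℝ → ℝ) t := fun f => Iff.rfl
  let F : polyBounded →ₗ.[ℝ] ℝ := ⟨LinearMap.range polyEval, L ∘ₗ e.symm.toLinearMap⟩
  have hF : ∀ p, F (e p) = L p := fun p => congrArg L (e.symm_apply_apply p)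
  obtain ⟨g, hgF, hg⟩ := riesz_extension s F
    (fun x hx => by
      obtain ⟨p, rfl⟩ := e.surjective x
      rw [hF]
      exact hL p ((hs _).1 hx))
    (fun y => by
      obtain ⟨p, hp⟩ := y.2
      refine ⟨e p, (hs _).2 fun t => ?_⟩
      have h : 0 ≤ p.eval t + (y : ℝ → ℝ) t := by linarith [neg_abs_le ((y : ℝ → ℝ) t), hp t]
      exact h)
  exact ⟨g, fun p => (hgF (e p)).trans (hF p), fun f hf => hg f ((hs f).2 hf)⟩

/-- **Haviland's theorem** on the real line. -/
theorem exists_measure_of_nonneg (L : ℝ[X] →ₗ[ℝ] ℝ)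
    (hL : ∀ p : ℝ[X], (∀ t, 0 ≤ p.eval t) → 0 ≤ L p) :
    ∃ μ : Measure ℝ, ∀ p : ℝ[X],
      Integrable (fun t => p.eval t) μ ∧ L p = ∫ t, p.eval t ∂μ := by
  obtain ⟨g, hgL, hg⟩ := exists_extension L hL
  let ι : C_c(ℝ, ℝ) →ₗ[ℝ] polyBounded :=
    { toFun := fun f => ⟨f, mem_polyBounded_of_compactlySupported f⟩
      map_add' := fun _ _ => rfl
      map_smul' := fun _ _ => rfl }
  let Λ : C_c(ℝ, ℝ) →ₚ[ℝ] ℝ := PositiveLinearMap.mk₀ (g ∘ₗ ι) fun f hf => hg _ hf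
  let μ := RealRMK.rieszMeasure Λ
  let trunc (p : ℝ[X]) (n : ℕ) : C_c(ℝ, ℝ) :=
    ⟨⟨fun t => p.eval t * cutoff n t, p.continuous.mul (continuous_cutoff n)⟩,
      (hasCompactSupport_cutoff n).mul_left⟩
  have htrunc : ∀ p n t, trunc p n t = p.eval t * cutoff n t := fun _ _ _ => rfl
  have hint : ∀ p n, ∫ t, trunc p n t ∂μ = g (ι (trunc p n)) := fun p n =>
    RealRMK.integral_rieszMeasure Λ _
  have hintegrable : ∀ p n, Integrable (trunc p n) μ := fun p n =>
    (trunc p n).continuous.integrable_of_hasCompactSupport (trunc p n).hasCompactSupport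
  have hlim : ∀ (p : ℝ[X]) (t : ℝ), Tendsto (fun n => trunc p n t) atTop (𝓝 (p.eval t)) :=
    fun p t => by simpa [htrunc] using (tendsto_cutoff t).const_mul (p.eval t)
  have hpos : ∀ p : ℝ[X], (∀ t, 0 ≤ p.eval t) → Integrable (fun t => p.eval t) μ := by
    intro p hp
    refine integrable_of_tendsto (G := fun n t => trunc p n t)
      (Eventually.of_forall (hlim p)) (fun n => (hintegrable p n).1) ?_
    have hbound : ∀ n, ∫⁻ t, ‖trunc p n t‖ₑ ∂μ ≤ ENNReal.ofReal (L p) := fun n => by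
      have hnn : ∀ t, 0 ≤ trunc p n t := fun t => mul_nonneg (hp t) (cutoff_nonneg n t)
      have hle : g (ι (trunc p n)) ≤ g (polyEval p) := by
        rw [← sub_nonneg, ← map_sub]
        refine hg _ fun t => ?_
        exact sub_nonneg.2 (mul_le_of_le_one_right (hp t) (cutoff_le_one n t))
      calc ∫⁻ t, ‖trunc p n t‖ₑ ∂μ = ∫⁻ t, ENNReal.ofReal (trunc p n t) ∂μ :=
            lintegral_congr fun t => Real.enorm_of_nonneg (hnn t)
        _ = ENNReal.ofReal (∫ t, trunc p n t ∂μ) :=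
            (ofReal_integral_eq_lintegral_ofReal (hintegrable p n)
              (Eventually.of_forall hnn)).symm
        _ ≤ ENNReal.ofReal (L p) :=
            ENNReal.ofReal_le_ofReal (by rw [hint, ← hgL]; exact hle)
    refine ne_top_of_le_ne_top ENNReal.ofReal_ne_top
      (liminf_le_of_frequently_le' (Frequently.of_forall hbound))
  refine ⟨μ, fun p => ?_⟩
  have hp : Integrable (fun t => p.eval t) μ :=
    (hpos (1 + p ^ 2) fun t => by simp only [eval_add, eval_one, eval_pow]; positivity).mono'
      p.continuous.aestronglyMeasurable
      (Eventually.of_forall fun t => by simpa using abs_le_one_add_sq (p.eval t))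
  refine ⟨hp, tendsto_nhds_unique (f := fun n => ∫ t, trunc p n t ∂μ) (l := atTop) ?_ ?_⟩
  · let q : ℝ[X] := X ^ 2 * (1 + p ^ 2)
    have hq : ∀ t, q.eval t = t ^ 2 * (1 + p.eval t ^ 2) := fun t => by simp [q]
    have hkey : ∀ n : ℕ, 0 < n → ∀ t, n * |p.eval t - trunc p n t| ≤ q.eval t := by
      intro n hn t
      have hn1 : (1 : ℝ) ≤ n := by exact_mod_cast hn
      rw [htrunc, hq]
      rcases le_or_gt |t| n with ht | ht
      · rw [cutoff_eq_one ht, mul_one, sub_self, abs_zero, mul_zero]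
        positivity
      · have h1 : |p.eval t - p.eval t * cutoff n t| ≤ 1 + p.eval t ^ 2 := by
          rw [← mul_one_sub, abs_mul, abs_of_nonneg (sub_nonneg.2 (cutoff_le_one n t))]
          exact (mul_le_of_le_one_right (abs_nonneg _)
            (by linarith [cutoff_nonneg n t])).trans (abs_le_one_add_sq _)
        have h2 : (n : ℝ) ≤ t ^ 2 := by
          rw [← sq_abs]
          nlinarith
        exact mul_le_mul h2 h1 (abs_nonneg _) (sq_nonneg t)
    have hg_le : ∀ n : ℕ, 0 < n → |g (ι (trunc p n)) - L p| ≤ L q / n := by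
      intro n hn
      have hn0 : (0 : ℝ) < n := by exact_mod_cast hn
      have h1 : 0 ≤ g (polyEval q - (n : ℝ) • (polyEval p - ι (trunc p n))) :=
        hg _ fun t => sub_nonneg.2
          ((mul_le_mul_of_nonneg_left (le_abs_self _) hn0.le).trans (hkey n hn t))
      have h2 : 0 ≤ g (polyEval q + (n : ℝ) • (polyEval p - ι (trunc p n))) :=
        hg _ fun t => by
          have h3 := hkey n hn t
          have h4 := mul_le_mul_of_nonneg_left (neg_abs_le (p.eval t - trunc p n t)) hn0.le
          have h5 : 0 ≤ q.eval t + n * (p.eval t - trunc p n t) := by linarith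
          exact h5
      simp only [map_sub, map_add, map_smul, smul_eq_mul, hgL] at h1 h2
      rw [abs_le, neg_le, le_div_iff₀ hn0, le_div_iff₀ hn0]
      constructor <;> linarith
    simp only [hint]
    rw [tendsto_iff_norm_sub_tendsto_zero]
    refine squeeze_zero' (Eventually.of_forall fun n => norm_nonneg _) ?_
      (tendsto_const_div_atTop_nhds_zero_nat (L q))
    filter_upwards [eventually_gt_atTop 0] with n hn using hg_le n hn
  · refine tendsto_integral_of_dominated_convergence (fun t => |p.eval t|)
      (fun n => (hintegrable p n).1) hp.abs (fun n => Eventually.of_forall fun t => ?_)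
      (Eventually.of_forall (hlim p))
    rw [htrunc, Real.norm_eq_abs, abs_mul, abs_of_nonneg (cutoff_nonneg n t)]
    exact mul_le_of_le_one_right (abs_nonneg _) (cutoff_le_one n t)

/-- The linear functional on real polynomials sending `X ^ n` to `ρ n`. -/
noncomputable def momentFunctional (ρ : ℕ → ℝ) : ℝ[X] →ₗ[ℝ] ℝ :=
  lsum fun n => LinearMap.mulRight ℝ (ρ n)

theorem momentFunctional_monomial (ρ : ℕ → ℝ) (n : ℕ) (a : ℝ) :
    momentFunctional ρ (monomial n a) = a * ρ n := by
  simp [momentFunctional, sum_monomial_index]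

theorem momentFunctional_mul_self_nonneg {ρ : ℕ → ℝ}
    (h : ∀ N : ℕ, (Matrix.of fun i j : Fin (N + 1) =>
      ((ρ ((i : ℕ) + (j : ℕ)) : ℂ))).PosSemidef) (p : ℝ[X]) :
    0 ≤ momentFunctional ρ (p * p) := by
  have hp := (h p.natDegree).dotProduct_mulVec_nonneg fun i => ((p.coeff i : ℝ) : ℂ)
  have hL : momentFunctional ρ (p * p) = ∑ i : Fin (p.natDegree + 1),
      p.coeff i * ∑ j : Fin (p.natDegree + 1), ρ (i + j) * p.coeff j := by
    conv_lhs => rw [p.as_sum_range]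
    rw [Finset.sum_range, Finset.sum_mul_sum]
    simp only [map_sum, monomial_mul_monomial, momentFunctional_monomial, Finset.mul_sum]
    exact Finset.sum_congr rfl fun i _ => Finset.sum_congr rfl fun j _ => by ring
  rw [hL]
  simp only [dotProduct, Matrix.mulVec, Pi.star_apply, Matrix.of_apply, RCLike.star_def,
    Complex.conj_ofReal] at hp
  exact_mod_cast hp

theorem posSemidef_hankel_of_moments {ρ : ℕ → ℝ} {μ : Measure ℝ}
    (h : ∀ i : ℕ, Integrable (fun t : ℝ => t ^ i) μ ∧ ρ i = ∫ t : ℝ, t ^ i ∂μ) (N : ℕ) :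
    (Matrix.of fun i j : Fin (N + 1) => ((ρ ((i : ℕ) + (j : ℕ)) : ℂ))).PosSemidef := by
  refine Matrix.PosSemidef.of_dotProduct_mulVec_nonneg ?_ fun x => ?_
  · ext i j
    simp [add_comm]
  have hi : ∀ i j : Fin (N + 1), Integrable
      (fun t : ℝ => star (x i) * (((t ^ (i + j : ℕ) : ℝ) : ℂ) * x j)) μ := fun i j =>
    (((h (i + j)).1.ofReal (𝕜 := ℂ)).mul_const (x j)).const_mul (star (x i))
  have key : star x ⬝ᵥ ((Matrix.of fun i j : Fin (N + 1) => ((ρ ((i : ℕ) + (j : ℕ)) : ℂ))).mulVec x)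
      = ∫ t : ℝ, ((Complex.normSq (∑ i, x i * (t : ℂ) ^ (i : ℕ)) : ℝ) : ℂ) ∂μ := by
    have hsum : ∀ t : ℝ, ((Complex.normSq (∑ i, x i * (t : ℂ) ^ (i : ℕ)) : ℝ) : ℂ) =
        ∑ i : Fin (N + 1), ∑ j : Fin (N + 1), star (x i) * (((t ^ (i + j : ℕ) : ℝ) : ℂ) * x j) := fun t => by
      rw [Complex.normSq_eq_conj_mul_self, map_sum, Finset.sum_mul_sum]
      refine Finset.sum_congr rfl fun i _ => Finset.sum_congr rfl fun j _ => ?_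
      simp only [map_mul, map_pow, Complex.conj_ofReal, RCLike.star_def, Complex.ofReal_pow]
      ring
    simp only [hsum]
    rw [integral_finsetSum _ fun i _ => integrable_finsetSum _ fun j _ => hi i j]
    simp only [dotProduct, Matrix.mulVec, Finset.mul_sum, Pi.star_apply, Matrix.of_apply]
    refine Finset.sum_congr rfl fun i _ => ?_
    rw [integral_finsetSum _ fun j _ => hi i j]
    refine Finset.sum_congr rfl fun j _ => ?_
    rw [integral_const_mul, integral_mul_const, integral_complex_ofReal, (h _).2]
  rw [key, integral_complex_ofReal]
  exact_mod_cast integral_nonneg fun t => Complex.normSq_nonneg _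

end HamburgerMoment

open HamburgerMoment

/-- Hamburger moment problem: a real sequence `(ρ_i)` is the moment sequence of a finite
positive Borel measure on `ℝ` if and only if every truncated Hankel matrix
`[ρ_{i+j}]_{0 ≤ i,j ≤ N}` is positive semidefinite. -/
theorem hamburger_moment_problem (ρ : ℕ → ℝ) :
    (∃ μ : Measure ℝ, IsFiniteMeasure μ ∧
        ∀ i : ℕ, Integrable (fun t : ℝ => t ^ i) μ ∧ ρ i = ∫ t : ℝ, t ^ i ∂μ) ↔
    (∀ N : ℕ,
        (Matrix.of fun i j : Fin (N + 1) =>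
          ((ρ ((i : ℕ) + (j : ℕ)) : ℂ))).PosSemidef) := by
  refine ⟨fun ⟨μ, _, h⟩ => posSemidef_hankel_of_moments h, fun h => ?_⟩
  have hsq : ∀ p, IsSumSq p → 0 ≤ momentFunctional ρ p := fun p hp => by
    induction hp with
    | zero => simp
    | sq_add a _ ih =>
      rw [map_add]
      exact add_nonneg (momentFunctional_mul_self_nonneg h a) ih
  obtain ⟨μ, hμ⟩ := exists_measure_of_nonneg (momentFunctional ρ)
    fun p hp => hsq p (isSumSq_of_eval_nonneg p hp)
  have hμ' : ∀ i : ℕ, Integrable (fun t : ℝ => t ^ i) μ ∧ ρ i = ∫ t : ℝ, t ^ i ∂μ := fun i => by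
    simpa [momentFunctional_monomial] using hμ (Polynomial.monomial i 1)
  refine ⟨μ, ?_, hμ'⟩
  have h1 : Integrable (fun _ : ℝ => (1 : ℝ)) μ := by simpa using (hμ' 0).1
  exact (integrable_const_iff_isFiniteMeasure one_ne_zero).1 h1
end
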